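/- Proposition 2 (representation of the truncated m-function): for every n ≥ 1 there exist λ_n ∈ ℂ with Im λ_n ≥ 0, d_n ∈ ℝ, and a finitely supported nonnegative measure μ_n on ℝ (a finite sum of nonnegative point masses) such that for every z ∈ ℂ with Im z ≠ 0 and z ∉ {λ_n, conj(λ_n)}, the matrix H_{[0,n]} − z·I is invertible and −((H_{[0,n]} − z·I)⁻¹)_{0,0} = (z + d_n + ∫ dμ_n(t)/(t−z))/((z − λ_n)(z − conj(λ_n))); moreover λ_n is the unique eigenvalue of nonpositive type of H_{[0,n]}. -/

import Mathlib

open MeasureTheory Complex Filter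

/-- The (n+1)×(n+1) truncation H_{[0,n]} of the non-symmetric Jacobi matrix. -/
noncomputable def JacobiH0 (a b : ℕ → ℝ) (n : ℕ) : Matrix (Fin (n + 1)) (Fin (n + 1)) ℂ :=
  Matrix.of fun i j =>
    if (i : ℕ) = (j : ℕ) then (a i : ℂ)
    else if (i : ℕ) + 1 = (j : ℕ) then (if (i : ℕ) = 0 then -(b 0 : ℂ) else (b (i : ℕ) : ℂ))
    else if (j : ℕ) + 1 = (i : ℕ) then (b (j : ℕ) : ℂ)
    else 0

/-- The n×n truncation H_{[1,n]} of the symmetric Jacobi matrix (entries shifted by one). -/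
noncomputable def JacobiH1 (a b : ℕ → ℝ) (n : ℕ) : Matrix (Fin n) (Fin n) ℂ :=
  Matrix.of fun i j =>
    if (i : ℕ) = (j : ℕ) then (a ((i : ℕ) + 1) : ℂ)
    else if (i : ℕ) + 1 = (j : ℕ) then (b ((i : ℕ) + 1) : ℂ)
    else if (j : ℕ) + 1 = (i : ℕ) then (b ((j : ℕ) + 1) : ℂ)
    else 0

/-- `lam` is an eigenvalue of nonpositive type of H_{[0,n]}. -/
def IsNPTev (a b : ℕ → ℝ) (n : ℕ) (lam : ℂ) : Prop :=
  0 ≤ lam.im ∧ ∃ f : Fin (n + 1) → ℂ, f ≠ 0 ∧ (JacobiH0 a b n).mulVec f = lam • f ∧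
    -‖f 0‖ ^ 2 + ∑ j : Fin n, ‖f j.succ‖ ^ 2 ≤ 0

/-- Cauchy transform of a Borel measure on ℝ. -/
noncomputable def cauchyT (σ : Measure ℝ) (z : ℂ) : ℂ := ∫ t, ((t : ℂ) - z)⁻¹ ∂σ

/-- A finite sum of nonnegative simple fractions is the Cauchy transform of a finite sum of
point masses. -/
lemma exists_cauchyT_eq_sum {ι : Type*} [Fintype ι] (t c : ι → ℝ) (hc : ∀ k, 0 ≤ c k) :
    ∃ (s : Finset ℝ) (w : ℝ → ℝ), (∀ x ∈ s, 0 ≤ w x) ∧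
      ∀ z : ℂ, cauchyT (∑ x ∈ s, ENNReal.ofReal (w x) • Measure.dirac x) z =
        ∑ k, (c k : ℂ) * ((t k : ℂ) - z)⁻¹ := by
  classical
  have hw : ∀ x, 0 ≤ ∑ k with t k = x, c k := fun x => Finset.sum_nonneg fun k _ => hc k
  refine ⟨Finset.univ.image t, fun x => ∑ k with t k = x, c k, fun x _ => hw x, fun z => ?_⟩
  have hint : ∀ x : ℝ, Integrable (fun u : ℝ => ((u : ℂ) - z)⁻¹)
      (ENNReal.ofReal (∑ k with t k = x, c k) • Measure.dirac x) := fun x =>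
    (integrable_dirac (by simp)).smul_measure ENNReal.ofReal_ne_top
  rw [cauchyT, integral_finsetSum_measure fun x _ => hint x]
  have hterm : ∀ x : ℝ, ∫ u : ℝ, ((u : ℂ) - z)⁻¹
      ∂(ENNReal.ofReal (∑ k with t k = x, c k) • Measure.dirac x) =
      ∑ k with t k = x, (c k : ℂ) * ((t k : ℂ) - z)⁻¹ := by
    intro x
    rw [integral_smul_measure, integral_dirac, ENNReal.toReal_ofReal (hw x), Complex.real_smul,
      Complex.ofReal_sum, Finset.sum_mul]
    refine Finset.sum_congr rfl fun k hk => ?_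
    rw [(Finset.mem_filter.1 hk).2]
  simp_rw [hterm]
  exact Finset.sum_fiberwise_of_maps_to (fun k _ => Finset.mem_image_of_mem t (Finset.mem_univ k)) _

lemma ofReal_sub_ne_zero {z : ℂ} (hz : z.im ≠ 0) (t : ℝ) : (t : ℂ) - z ≠ 0 := by
  intro h
  apply hz
  have := congrArg Complex.im h
  simpa using this

open Matrix in
/-- The resolvent form of a Hermitian matrix is the Cauchy transform of a discrete measure. -/
lemma Matrix.IsHermitian.exists_resolvent_eq_cauchyT {ι : Type*} [Fintype ι] {Q : Matrix ι ι ℂ}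
    (hQ : Q.IsHermitian) (v : ι → ℂ) :
    ∃ (s : Finset ℝ) (w : ℝ → ℝ), (∀ x ∈ s, 0 ≤ w x) ∧
      ∀ z : ℂ, z.im ≠ 0 → ∃ x : ι → ℂ, Q *ᵥ x - z • x = v ∧
        star v ⬝ᵥ x =
          cauchyT (∑ x ∈ s, ENNReal.ofReal (w x) • Measure.dirac x) z := by
  classical
  let u : ι → ι → ℂ := fun k => hQ.eigenvectorBasis k
  let p : ι → ℂ := fun k => star (u k) ⬝ᵥ v
  have hu : ∀ k, Q *ᵥ u k = (hQ.eigenvalues k : ℂ) • u k := fun k => hQ.mulVec_eigenvectorBasis k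
  have hv : ∑ k, p k • u k = v := by
    have h := congrArg WithLp.ofLp (hQ.eigenvectorBasis.sum_repr' (WithLp.toLp 2 v))
    simp only [WithLp.ofLp_sum, WithLp.ofLp_smul] at h
    rw [← h]
    refine Finset.sum_congr rfl fun k _ => ?_
    congr 1
    simp [p, u, EuclideanSpace.inner_eq_star_dotProduct, dotProduct_comm]
  have hp : ∀ k, star v ⬝ᵥ u k = star (p k) := fun k => by simp only [p]; rw [star_dotProduct]
  obtain ⟨s, w, hw, hs⟩ := exists_cauchyT_eq_sum hQ.eigenvalues (fun k => Complex.normSq (p k))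
    fun k => Complex.normSq_nonneg _
  refine ⟨s, w, hw, fun z hz => ⟨∑ k, (p k * ((hQ.eigenvalues k : ℂ) - z)⁻¹) • u k, ?_, ?_⟩⟩
  · rw [mulVec_sum, Finset.smul_sum, ← Finset.sum_sub_distrib]
    conv_rhs => rw [← hv]
    refine Finset.sum_congr rfl fun k _ => ?_
    rw [mulVec_smul, hu, smul_smul, smul_smul, ← sub_smul]
    congr 1
    have := ofReal_sub_ne_zero hz (hQ.eigenvalues k)
    field_simp
  · rw [hs, dotProduct_sum]
    refine Finset.sum_congr rfl fun k _ => ?_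
    rw [dotProduct_smul, hp, smul_eq_mul, Complex.normSq_eq_conj_mul_self, starRingEnd_apply]
    ring

open Matrix in
lemma Matrix.IsHermitian.star_dotProduct_mulVec {ι : Type*} [Fintype ι] {A : Matrix ι ι ℂ}
    (hA : A.IsHermitian) (u v : ι → ℂ) : star u ⬝ᵥ (A *ᵥ v) = star (A *ᵥ u) ⬝ᵥ v := by
  rw [star_mulVec, hA.eq, dotProduct_mulVec]

open Matrix in
/-- For a Hermitian matrix `A` and a unit vector `w`, the function `-⟨w, (A - z)⁻¹ w⟩⁻¹` has the
form `z + d + ∫ dμ(t)/(t - z)`. Here `X = κ (A - z)⁻¹ w`, normalized by `⟨w, X⟩ = 1`. -/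
lemma Matrix.IsHermitian.exists_neg_inv_resolvent_eq {ι : Type*} [Fintype ι] {A : Matrix ι ι ℂ}
    (hA : A.IsHermitian) (w : ι → ℂ) (hw : star w ⬝ᵥ w = 1) :
    ∃ (d : ℝ) (s : Finset ℝ) (m : ℝ → ℝ), (∀ x ∈ s, 0 ≤ m x) ∧
      ∀ z : ℂ, z.im ≠ 0 → ∃ (X : ι → ℂ) (κ : ℂ), A *ᵥ X - z • X = κ • w ∧ star w ⬝ᵥ X = 1 ∧
        -κ = z + d + cauchyT (∑ x ∈ s, ENNReal.ofReal (m x) • Measure.dirac x) z := by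
  classical
  set α : ℂ := star w ⬝ᵥ (A *ᵥ w) with hα
  have hαs : star α = α := by
    rw [hα, ← star_dotProduct, hA.star_dotProduct_mulVec]
  let P : Matrix ι ι ℂ := 1 - vecMulVec w (star w)
  have hP : P.IsHermitian := by
    ext i j
    by_cases h : i = j
    · simp [P, vecMulVec_apply, h, mul_comm]
    · simp [P, vecMulVec_apply, h, Ne.symm h, mul_comm]
  have hPx : ∀ x, P *ᵥ x = x - (star w ⬝ᵥ x) • w := by
    intro x
    simp [P, sub_mulVec, vecMulVec_mulVec]
  have hQ : (P * A * P).IsHermitian := by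
    simpa [hP.eq] using isHermitian_conjTranspose_mul_mul P hA
  obtain ⟨s, m, hm, hs⟩ := hQ.exists_resolvent_eq_cauchyT (A *ᵥ w - α • w)
  refine ⟨-α.re, s, m, hm, fun z hz => ?_⟩
  obtain ⟨x, hx, hxc⟩ := hs z hz
  have hz0 : z ≠ 0 := by rintro rfl; simp at hz
  rw [← mulVec_mulVec, ← mulVec_mulVec] at hx
  have hwx : star w ⬝ᵥ x = 0 := by
    have h := congrArg (fun y => star w ⬝ᵥ y) hx
    simp only [hPx (A *ᵥ _), dotProduct_sub, dotProduct_smul, hw, smul_eq_mul, ← hα] at h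
    have : z * (star w ⬝ᵥ x) = 0 := by linear_combination -h
    exact (mul_eq_zero.1 this).resolve_left hz0
  rw [hPx x, hwx, zero_smul, sub_zero, hPx] at hx
  refine ⟨w - x, α - z - star w ⬝ᵥ (A *ᵥ x), ?_, ?_, ?_⟩
  · rw [mulVec_sub]
    ext i
    have := congrFun hx i
    simp only [Pi.sub_apply, Pi.smul_apply, smul_eq_mul] at this ⊢
    linear_combination -this
  · rw [dotProduct_sub, hw, hwx, sub_zero]
  · have hre : (α.re : ℂ) = α := Complex.conj_eq_iff_re.1 hαs
    rw [← hxc, star_sub, star_smul, sub_dotProduct, smul_dotProduct, hwx,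
      hA.star_dotProduct_mulVec w x]
    push_cast
    rw [hre]
    simp
    ring

/-- The matrix obtained from `C` by adding the first row `(α, -β)` and the first column
`(α, β)`. -/
def skewBordered {n : ℕ} (α : ℂ) (β : Fin n → ℂ) (C : Matrix (Fin n) (Fin n) ℂ) :
    Matrix (Fin (n + 1)) (Fin (n + 1)) ℂ :=
  Matrix.of (Fin.cons (Fin.cons α (-β)) fun i => Fin.cons (β i) (C i))

namespace skewBordered

open Matrix

variable {n : ℕ} {α : ℂ} {β : Fin n → ℂ} {C : Matrix (Fin n) (Fin n) ℂ}

lemma mulVec_zero (f : Fin (n + 1) → ℂ) :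
    (skewBordered α β C *ᵥ f) 0 = α * f 0 - β ⬝ᵥ Fin.tail f := by
  simp [skewBordered, mulVec, dotProduct, Fin.sum_univ_succ, Fin.tail, sub_eq_add_neg]

lemma mulVec_succ (f : Fin (n + 1) → ℂ) (i : Fin n) :
    (skewBordered α β C *ᵥ f) i.succ = f 0 * β i + (C *ᵥ Fin.tail f) i := by
  simp [skewBordered, mulVec, dotProduct, Fin.sum_univ_succ, Fin.tail, mul_comm]

lemma mulVec_eq_smul_iff {f : Fin (n + 1) → ℂ} {l : ℂ} :
    skewBordered α β C *ᵥ f = l • f ↔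
      α * f 0 - β ⬝ᵥ Fin.tail f = l * f 0 ∧
        f 0 • β + C *ᵥ Fin.tail f = l • Fin.tail f := by
  rw [funext_iff, Fin.forall_fin_succ, mulVec_zero, funext_iff]
  simp [mulVec_succ, Fin.tail]

lemma trace_eq : (skewBordered α β C).trace = α + C.trace := by
  simp [skewBordered, trace, Fin.sum_univ_succ]

/-- Eigenvectors are orthogonal for the indefinite form `-f₀ g₀ + ∑ fⱼ gⱼ`, up to the defect in
the corner entry. -/
lemma indefinite_form_identity (hC : C.IsHermitian) (hβ : star β = β) {α' l l' : ℂ}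
    {f f' : Fin (n + 1) → ℂ} (h : skewBordered α β C *ᵥ f = l • f)
    (h' : skewBordered α' β C *ᵥ f' = l' • f') :
    (l - star l') * (star (Fin.tail f') ⬝ᵥ Fin.tail f - star (f' 0) * f 0) =
      -(α - star α') * (star (f' 0) * f 0) := by
  obtain ⟨h0, h1⟩ := mulVec_eq_smul_iff.1 h
  obtain ⟨h0', h1'⟩ := mulVec_eq_smul_iff.1 h'
  have e0 := congrArg star h0'
  simp only [star_sub, star_mul', ← star_dotProduct_star, hβ] at e0
  have e1 := congrArg (fun y => star (Fin.tail f') ⬝ᵥ y) h1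
  have e2 := congrArg (fun y => star y ⬝ᵥ Fin.tail f) h1'
  simp only [star_add, star_smul, add_dotProduct, smul_dotProduct, dotProduct_add, dotProduct_smul,
    hβ, smul_eq_mul, hC.star_dotProduct_mulVec] at e1 e2
  linear_combination e2 - e1 - f 0 * e0 + star (f' 0) * h0

lemma star_dotProduct_self_eq {ι : Type*} [Fintype ι] (y : ι → ℂ) :
    star y ⬝ᵥ y = ((∑ i, ‖y i‖ ^ 2 : ℝ) : ℂ) := by
  simp [dotProduct, Complex.conj_mul']

/-- An eigenvector of nonpositive type can be normalized to have first entry `1`. -/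
lemma exists_normalized {M : Matrix (Fin (n + 1)) (Fin (n + 1)) ℂ} {l : ℂ} {f : Fin (n + 1) → ℂ}
    (hf : f ≠ 0) (h : M *ᵥ f = l • f) (hle : -‖f 0‖ ^ 2 + ∑ j : Fin n, ‖f j.succ‖ ^ 2 ≤ 0) :
    ∃ g : Fin (n + 1) → ℂ, M *ᵥ g = l • g ∧ g 0 = 1 ∧ ∑ j : Fin n, ‖g j.succ‖ ^ 2 ≤ 1 := by
  have h0 : f 0 ≠ 0 := by
    intro h0
    rw [h0] at hle
    have hsum : ∑ j : Fin n, ‖f j.succ‖ ^ 2 = 0 :=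
      le_antisymm (by simpa using hle) (Finset.sum_nonneg fun _ _ => by positivity)
    rw [Finset.sum_eq_zero_iff_of_nonneg fun _ _ => by positivity] at hsum
    apply hf
    ext j
    refine Fin.cases h0 (fun i => ?_) j
    simpa using hsum i (Finset.mem_univ i)
  refine ⟨(f 0)⁻¹ • f, ?_, by simp [h0], ?_⟩
  · rw [mulVec_smul, h, smul_comm]
  · have hpos : 0 < ‖f 0‖ ^ 2 := by positivity
    have : ∑ j : Fin n, ‖((f 0)⁻¹ • f) j.succ‖ ^ 2 = (‖f 0‖ ^ 2)⁻¹ * ∑ j : Fin n, ‖f j.succ‖ ^ 2 := by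
      rw [Finset.mul_sum]
      refine Finset.sum_congr rfl fun j _ => ?_
      simp [mul_pow]
    rw [this, inv_mul_le_one₀ hpos]
    linarith

/-- Eigenvalues of nonpositive type in the closed upper half plane are unique. -/
lemma eigenvalue_unique (hC : C.IsHermitian) (hβ : star β = β) (hα : star α = α) {l l' : ℂ}
    {f f' : Fin (n + 1) → ℂ} (hl : 0 ≤ l.im) (hl' : 0 ≤ l'.im)
    (h : skewBordered α β C *ᵥ f = l • f) (h' : skewBordered α β C *ᵥ f' = l' • f')
    (h0 : f 0 = 1) (h0' : f' 0 = 1) (hle : ∑ j : Fin n, ‖f j.succ‖ ^ 2 ≤ 1)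
    (hle' : ∑ j : Fin n, ‖f' j.succ‖ ^ 2 ≤ 1) : l = l' := by
  have hform := indefinite_form_identity hC hβ h h'
  rw [hα, sub_self, neg_zero, zero_mul, h0, h0', star_one, one_mul] at hform
  rcases mul_eq_zero.1 hform with hll | hff
  · have hre := congrArg Complex.re hll
    have him := congrArg Complex.im hll
    simp at hre him
    apply Complex.ext <;> linarith
  · have key : ∑ j : Fin n, ‖f j.succ - f' j.succ‖ ^ 2 = ∑ j : Fin n, ‖f j.succ‖ ^ 2 +
        ∑ j : Fin n, ‖f' j.succ‖ ^ 2 - 2 * (star (Fin.tail f') ⬝ᵥ Fin.tail f).re := by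
      rw [dotProduct, Complex.re_sum, Finset.mul_sum, ← Finset.sum_add_distrib,
        ← Finset.sum_sub_distrib]
      refine Finset.sum_congr rfl fun j _ => ?_
      simp only [← Complex.normSq_eq_norm_sq, Complex.normSq_sub, Fin.tail, Pi.star_apply]
      simp
      ring
    have h1 : star (Fin.tail f') ⬝ᵥ Fin.tail f = 1 := by linear_combination hff
    rw [h1, Complex.one_re] at key
    have hz : ∑ j : Fin n, ‖f j.succ - f' j.succ‖ ^ 2 = 0 :=
      le_antisymm (by linarith) (Finset.sum_nonneg fun _ _ => by positivity)
    rw [Finset.sum_eq_zero_iff_of_nonneg fun _ _ => by positivity] at hz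
    have hff' : f = f' := by
      ext j
      refine Fin.cases (by rw [h0, h0']) (fun i => ?_) j
      simpa [sub_eq_zero] using hz i (Finset.mem_univ i)
    subst hff'
    have := congrFun (h.symm.trans h') 0
    simpa [h0] using this

/-- After moving the corner entry into the upper half plane, there is an eigenvector of
nonpositive type with eigenvalue in the upper half plane. -/
lemma exists_eigenvector_of_corner_add (hC : C.IsHermitian) (hβ : star β = β) (hα : star α = α)
    {ε : ℝ} (hε : 0 < ε) :
    ∃ (l : ℂ) (f : Fin (n + 1) → ℂ), 0 ≤ l.im ∧
      skewBordered (α + ε * Complex.I) β C *ᵥ f = l • f ∧ f 0 = 1 ∧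
      ∑ j : Fin n, ‖f j.succ‖ ^ 2 ≤ 1 := by
  set M := skewBordered (α + ε * Complex.I) β C with hM
  have hαim : α.im = 0 := Complex.conj_eq_iff_im.1 hα
  have htr : M.trace.im = ε := by
    have hCtr : C.trace.im = 0 := by
      apply Complex.conj_eq_iff_im.1
      have := congrArg trace hC.eq
      rwa [trace_conjTranspose] at this
    rw [hM, trace_eq]
    simp [hαim, hCtr]
  obtain ⟨l, hl, hlim⟩ : ∃ l ∈ M.charpoly.roots, 0 < l.im := by
    by_contra! hcon
    have : M.trace.im ≤ 0 := by
      rw [trace_eq_sum_roots_charpoly, ← Complex.imCLM_apply, map_multiset_sum]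
      refine (Multiset.sum_le_card_nsmul _ 0 fun x hx => ?_).trans (smul_zero _).le
      obtain ⟨l, hl, rfl⟩ := Multiset.mem_map.1 hx
      exact hcon l hl
    linarith
  have hdet : (M - l • 1).det = 0 := by
    have h := (Polynomial.mem_roots'.1 hl).2
    rw [Polynomial.IsRoot, eval_charpoly] at h
    rw [← neg_sub, det_neg, smul_one_eq_diagonal, ← scalar_apply, h, mul_zero]
  obtain ⟨f, hf, hMf⟩ := exists_mulVec_eq_zero_iff.2 hdet
  have hMf : M *ᵥ f = l • f := by
    rw [sub_mulVec, smul_mulVec, one_mulVec, sub_eq_zero] at hMf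
    exact hMf
  have hform := indefinite_form_identity hC hβ hMf hMf
  rw [star_dotProduct_self_eq] at hform
  have him := congrArg Complex.im hform
  have hle : -‖f 0‖ ^ 2 + ∑ j : Fin n, ‖f j.succ‖ ^ 2 ≤ 0 := by
    have e : star (f 0) * f 0 = ((‖f 0‖ ^ 2 : ℝ) : ℂ) := by simp [Complex.conj_mul']
    rw [e, ← Complex.ofReal_sub, Complex.im_mul_ofReal, Complex.im_mul_ofReal] at him
    have e1 : (l - star l).im = 2 * l.im := by simp; ring
    have e2 : (-(α + ε * Complex.I - star (α + ε * Complex.I))).im = -2 * ε := by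
      simp [hαim]; ring
    rw [e1, e2] at him
    by_contra! hcon
    have h1 : 0 < 2 * l.im * (∑ j : Fin n, ‖f j.succ‖ ^ 2 - ‖f 0‖ ^ 2) :=
      mul_pos (by linarith) (by linarith)
    have h2 : 0 ≤ ε * ‖f 0‖ ^ 2 := by positivity
    simp only [Fin.tail] at him
    linarith
  obtain ⟨g, hg, hg0, hg1⟩ := exists_normalized hf hMf hle
  exact ⟨l, g, hlim.le, hg, hg0, hg1⟩

/-- Existence of an eigenvalue of nonpositive type (Pontryagin's theorem for this matrix). -/
lemma exists_eigenvector (hC : C.IsHermitian) (hβ : star β = β) (hα : star α = α) :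
    ∃ (l : ℂ) (f : Fin (n + 1) → ℂ), 0 ≤ l.im ∧
      skewBordered α β C *ᵥ f = l • f ∧ f 0 = 1 ∧ ∑ j : Fin n, ‖f j.succ‖ ^ 2 ≤ 1 := by
  let K : Set (Fin (n + 1) → ℂ) := {f | f 0 = 1 ∧ ∑ j : Fin n, ‖f j.succ‖ ^ 2 ≤ 1}
  have hK : IsCompact K := by
    refine Metric.isCompact_of_isClosed_isBounded ?_ ?_
    · exact (isClosed_eq (f := fun f : Fin (n + 1) → ℂ => f 0) (by fun_prop) continuous_const).inter
        (isClosed_le (f := fun f : Fin (n + 1) → ℂ => ∑ j : Fin n, ‖f j.succ‖ ^ 2) (by fun_prop)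
          continuous_const)
    · refine (Metric.isBounded_closedBall (x := (0 : Fin (n + 1) → ℂ)) (r := 1)).subset ?_
      rintro f ⟨h0, h1⟩
      rw [mem_closedBall_zero_iff, pi_norm_le_iff_of_nonneg zero_le_one]
      refine Fin.cases (by simp [h0]) fun i => ?_
      have := (Finset.single_le_sum (f := fun j : Fin n => ‖f j.succ‖ ^ 2)
        (fun _ _ => by positivity) (Finset.mem_univ i)).trans h1
      exact (sq_le_one_iff₀ (norm_nonneg _)).1 this
  let ε : ℕ → ℝ := fun k => 1 / ((k : ℝ) + 1)
  choose l f hl hf hf0 hf1 using fun k : ℕ =>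
    exists_eigenvector_of_corner_add hC hβ hα (ε := ε k) Nat.one_div_pos_of_nat
  obtain ⟨g, hg, φ, hφ, hlim⟩ := hK.tendsto_subseq fun k => ⟨hf0 k, hf1 k⟩
  have hε : Tendsto (fun k => ((ε (φ k) : ℝ) : ℂ) * Complex.I) atTop (nhds 0) := by
    have h1 : Tendsto (fun k => ε (φ k)) atTop (nhds 0) :=
      tendsto_one_div_add_atTop_nhds_zero_nat.comp hφ.tendsto_atTop
    have h2 := ((Complex.continuous_ofReal.tendsto 0).comp h1).mul_const Complex.I
    simpa using h2
  have hmul : Tendsto (fun k => skewBordered α β C *ᵥ f (φ k)) atTop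
      (nhds (skewBordered α β C *ᵥ g)) :=
    ((Continuous.matrix_mulVec continuous_const continuous_id).tendsto g).comp hlim
  have hlk : ∀ k, l (φ k) = (skewBordered α β C *ᵥ f (φ k)) 0 + ε (φ k) * Complex.I := by
    intro k
    have := (mulVec_eq_smul_iff.1 (hf (φ k))).1
    rw [hf0] at this
    rw [mulVec_zero, hf0]
    linear_combination -this
  have hllim : Tendsto (fun k => l (φ k)) atTop (nhds ((skewBordered α β C *ᵥ g) 0)) := by
    simp_rw [hlk]
    simpa using (((continuous_apply 0).tendsto _).comp hmul).add hε
  refine ⟨(skewBordered α β C *ᵥ g) 0, g, ?_, ?_, hg.1, hg.2⟩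
  · exact ge_of_tendsto' ((Complex.continuous_im.tendsto _).comp hllim) fun k => hl _
  · ext j
    refine Fin.cases (by simp [hg.1]) (fun i => ?_) j
    have h1 : Tendsto (fun k => (skewBordered α β C *ᵥ f (φ k)) i.succ) atTop
        (nhds ((skewBordered α β C *ᵥ g) i.succ)) := ((continuous_apply i.succ).tendsto _).comp hmul
    have h2 : Tendsto (fun k => l (φ k) * f (φ k) i.succ) atTop
        (nhds ((skewBordered α β C *ᵥ g) 0 * g i.succ)) :=
      hllim.mul (((continuous_apply i.succ).tendsto _).comp hlim)
    refine tendsto_nhds_unique h1 (h2.congr fun k => ?_)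
    have := congrFun (hf (φ k)) i.succ
    rw [mulVec_succ] at this ⊢
    exact this.symm

/-- The first column of the resolvent of a skew-bordered matrix, in terms of an eigenvector of
nonpositive type. -/
lemma exists_resolvent_column (hC : C.IsHermitian) (hβ : star β = β) (hα : star α = α) {l : ℂ}
    {f : Fin (n + 1) → ℂ} (h : skewBordered α β C *ᵥ f = l • f) (h0 : f 0 = 1)
    (hle : ∑ j : Fin n, ‖f j.succ‖ ^ 2 ≤ 1) :
    ∃ (d : ℝ) (s : Finset ℝ) (m : ℝ → ℝ), (∀ x ∈ s, 0 ≤ m x) ∧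
      ∀ z : ℂ, z.im ≠ 0 → z ≠ l → z ≠ star l → ∃ u : Fin (n + 1) → ℂ,
        (skewBordered α β C - z • 1) *ᵥ u = Pi.single 0 1 ∧
        -u 0 = (z + d + cauchyT (∑ x ∈ s, ENNReal.ofReal (m x) • Measure.dirac x) z) /
          ((z - l) * (z - star l)) := by
  set y := Fin.tail f with hy
  set S : ℝ := ∑ j : Fin n, ‖f j.succ‖ ^ 2 with hS
  have hyy : star y ⬝ᵥ y = (S : ℂ) := star_dotProduct_self_eq y
  set ρ : ℝ := √(1 - S) with hρ
  have hρρ : (ρ : ℂ) * ρ = 1 - S := by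
    rw [← Complex.ofReal_mul, Real.mul_self_sqrt (by linarith)]
    push_cast
    rfl
  let A : Matrix (Unit ⊕ Fin n) (Unit ⊕ Fin n) ℂ :=
    fromBlocks (diagonal fun _ => (l.re : ℂ)) 0 0 C
  have hA : A.IsHermitian :=
    IsHermitian.fromBlocks (isHermitian_diagonal_iff.2 fun _ => Complex.conj_ofReal _) (by simp) hC
  let w : Unit ⊕ Fin n → ℂ := Sum.elim (fun _ => (ρ : ℂ)) y
  have hw : star w ⬝ᵥ w = 1 := by
    have : star w ⬝ᵥ w = ρ * ρ + star y ⬝ᵥ y := by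
      simp [w, dotProduct]
    rw [this, hyy, hρρ]
    ring
  obtain ⟨d, s, m, hm, hX⟩ := hA.exists_neg_inv_resolvent_eq w hw
  refine ⟨d, s, m, hm, fun z hz hzl hzl' => ?_⟩
  obtain ⟨X, κ, hX1, hX2, hX3⟩ := hX z hz
  have hD : (z - l) * (z - star l) ≠ 0 := mul_ne_zero (sub_ne_zero.2 hzl) (sub_ne_zero.2 hzl')
  set D := (z - l) * (z - star l) with hDdef
  set x : Fin n → ℂ := X ∘ Sum.inr with hx
  have hXl : l.re * X (Sum.inl ()) - z * X (Sum.inl ()) = κ * ρ := by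
    have := congrFun hX1 (Sum.inl ())
    simpa [A, w, fromBlocks_mulVec, mulVec_diagonal] using this
  have hXr : C *ᵥ x - z • x = κ • y := by
    ext i
    have := congrFun hX1 (Sum.inr i)
    simpa [A, w, hx, fromBlocks_mulVec] using this
  have hwX : ρ * X (Sum.inl ()) + star y ⬝ᵥ x = 1 := by
    rw [← hX2]
    simp [w, dotProduct, x]
  obtain ⟨e0, e1⟩ := mulVec_eq_smul_iff.1 h
  rw [h0, mul_one, mul_one, ← hy] at e0
  rw [h0, one_smul, ← hy] at e1
  have hreal : (l - star l) * (S - 1) = 0 := by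
    have := indefinite_form_identity hC hβ h h
    rw [← hy, hyy, h0, hα] at this
    simpa using this
  have hβx : β ⬝ᵥ x = star l * (star y ⬝ᵥ x) - z * (star y ⬝ᵥ x) - κ * S := by
    have h1 := congrArg (fun v => star v ⬝ᵥ x) e1
    simp only [star_add, star_smul, add_dotProduct, smul_dotProduct, hβ, smul_eq_mul,
      ← hC.star_dotProduct_mulVec] at h1
    have h2 := congrArg (fun v => star y ⬝ᵥ v) hXr
    simp only [dotProduct_sub, dotProduct_smul, smul_eq_mul, hyy] at h2
    linear_combination h1 - h2
  have hcorner : (l.re - star l) * (ρ * X (Sum.inl ())) = 0 := by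
    rcases mul_eq_zero.1 hreal with hl | hS1
    · have : (l.re : ℂ) = star l := by
        rw [Complex.conj_eq_iff_re.1 (sub_eq_zero.1 hl).symm]
        exact (sub_eq_zero.1 hl)
      rw [this, sub_self, zero_mul]
    · have : (ρ : ℂ) = 0 := mul_self_eq_zero.1 (by rw [hρρ]; linear_combination -hS1)
      rw [this, zero_mul, mul_zero]
  refine ⟨Fin.cons (D⁻¹ * κ) (D⁻¹ • (κ • y + (z - l) • x)), ?_, ?_⟩
  · rw [sub_mulVec, smul_mulVec, one_mulVec]
    ext j
    refine Fin.cases ?_ (fun i => ?_) j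
    · simp only [Pi.sub_apply, Pi.smul_apply, mulVec_zero, Fin.cons_zero, Fin.tail_cons,
        dotProduct_smul, dotProduct_add, smul_eq_mul, Pi.single_eq_same, hβx]
      have hDD : D⁻¹ * ((z - l) * (z - star l)) = 1 := inv_mul_cancel₀ hD
      linear_combination D⁻¹ * κ * e0 + D⁻¹ * (z - l) * ((z - star l) * hwX + κ * hρρ + ρ * hXl -
        hcorner) + hDD
    · simp only [Pi.sub_apply, Pi.smul_apply, mulVec_succ, Fin.cons_zero, Fin.cons_succ,
        Fin.tail_cons, mulVec_smul, mulVec_add, Pi.add_apply, smul_eq_mul]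
      rw [Pi.single_eq_of_ne (Fin.succ_ne_zero i)]
      have h1 := congrFun e1 i
      have h2 := congrFun hXr i
      simp only [Pi.add_apply, Pi.sub_apply, Pi.smul_apply, smul_eq_mul] at h1 h2
      linear_combination D⁻¹ * κ * h1 + D⁻¹ * (z - l) * h2
  · rw [Fin.cons_zero, ← hX3]
    field_simp

end skewBordered

lemma JacobiH1_isHermitian (a b : ℕ → ℝ) (n : ℕ) : (JacobiH1 a b n).IsHermitian := by
  ext i j
  simp only [JacobiH1, Matrix.conjTranspose_apply, Matrix.of_apply]
  rcases lt_trichotomy (i : ℕ) (j : ℕ) with h | h | h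
  · split_ifs <;> first | omega | simp
  · simp [h]
  · split_ifs <;> first | omega | simp

lemma JacobiH0_eq_skewBordered (a b : ℕ → ℝ) (n : ℕ) :
    JacobiH0 a b n =
      skewBordered (a 0 : ℂ) (fun i => if (i : ℕ) = 0 then (b 0 : ℂ) else 0) (JacobiH1 a b n) := by
  ext i j
  refine Fin.cases ?_ (fun i => ?_) i <;> refine Fin.cases ?_ (fun j => ?_) j
  · simp [JacobiH0, skewBordered]
  · simp only [JacobiH0, skewBordered, Matrix.of_apply, Fin.cons_zero, Fin.cons_succ]
    split_ifs <;> simp_all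
  · simp [JacobiH0, skewBordered]
  · simp [JacobiH0, JacobiH1, skewBordered]

lemma JacobiH0_mulVec_star (a b : ℕ → ℝ) (n : ℕ) (f : Fin (n + 1) → ℂ) :
    (JacobiH0 a b n).mulVec (star f) = star ((JacobiH0 a b n).mulVec f) := by
  have hreal : ∀ i j, star (JacobiH0 a b n i j) = JacobiH0 a b n i j := by
    intro i j
    simp only [JacobiH0, Matrix.of_apply]
    split_ifs <;> simp
  ext i
  simp only [Matrix.mulVec, dotProduct, Pi.star_apply, star_sum, star_mul', hreal]

/-- Proposition 2: representation of the truncated m-function. -/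
theorem stmt_6 (a b : ℕ → ℝ) (hb : ∀ j, 0 < b j) (n : ℕ) (hn : 1 ≤ n) :
    ∃ (lam : ℂ) (dn : ℝ) (s : Finset ℝ) (w : ℝ → ℝ),
      0 ≤ lam.im ∧ (∀ t ∈ s, 0 ≤ w t) ∧
      (∀ z : ℂ, z.im ≠ 0 → z ≠ lam → z ≠ (starRingEnd ℂ) lam →
        IsUnit (JacobiH0 a b n - z • 1) ∧
        -(((JacobiH0 a b n - z • 1)⁻¹) 0 0) =
          (z + (dn : ℂ) + cauchyT (∑ t ∈ s, ENNReal.ofReal (w t) • MeasureTheory.Measure.dirac t) z) /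
            ((z - lam) * (z - (starRingEnd ℂ) lam))) ∧
      IsNPTev a b n lam ∧ ∀ lam' : ℂ, IsNPTev a b n lam' → lam' = lam := by
  have hC := JacobiH1_isHermitian a b n
  have hH := JacobiH0_eq_skewBordered a b n
  set β : Fin n → ℂ := fun i => if (i : ℕ) = 0 then (b 0 : ℂ) else 0 with hβdef
  have hβ : star β = β := by
    ext i
    simp only [β, Pi.star_apply]
    split_ifs <;> simp
  have hα : star (a 0 : ℂ) = a 0 := Complex.conj_ofReal _
  obtain ⟨lam, f, hlam, hf, hf0, hf1⟩ := skewBordered.exists_eigenvector hC hβ hα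
  obtain ⟨d, s, m, hm, hu⟩ := skewBordered.exists_resolvent_column hC hβ hα hf hf0 hf1
  have huniq : ∀ lam' : ℂ, IsNPTev a b n lam' → lam' = lam := by
    rintro l ⟨hl, g, hg, hgl, hgle⟩
    rw [hH] at hgl
    obtain ⟨g', hg', hg0, hg1⟩ := skewBordered.exists_normalized hg hgl hgle
    exact skewBordered.eigenvalue_unique hC hβ hα hl hlam hg' hf hg0 hf0 hg1 hf1
  have hnonreal : ∀ (z : ℂ) (g : Fin (n + 1) → ℂ), 0 < z.im → g ≠ 0 →
      (JacobiH0 a b n).mulVec g = z • g → z = lam := by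
    intro z g hz hg hgz
    refine huniq z ⟨hz.le, g, hg, hgz, ?_⟩
    rw [hH] at hgz
    have hform := skewBordered.indefinite_form_identity hC hβ hgz hgz
    rw [hα, sub_self, neg_zero, zero_mul, skewBordered.star_dotProduct_self_eq] at hform
    rcases mul_eq_zero.1 hform with h | h
    · have := congrArg Complex.im h
      simp at this
      linarith
    · have := congrArg Complex.re h
      have e : star (g 0) * g 0 = ((‖g 0‖ ^ 2 : ℝ) : ℂ) := by simp [Complex.conj_mul']
      rw [e, ← Complex.ofReal_sub, Complex.ofReal_re] at this
      simp only [Fin.tail, Complex.zero_re] at this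
      linarith
  refine ⟨lam, d, s, m, hlam, hm, fun z hz hzl hzl' => ?_, ⟨hlam, f, ?_, hH ▸ hf, ?_⟩, huniq⟩
  · have hdet : (JacobiH0 a b n - z • 1).det ≠ 0 := by
      intro hdet
      obtain ⟨g, hg, hgz⟩ := Matrix.exists_mulVec_eq_zero_iff.2 hdet
      rw [Matrix.sub_mulVec, Matrix.smul_mulVec, Matrix.one_mulVec, sub_eq_zero] at hgz
      rcases lt_or_gt_of_ne hz with hneg | hpos
      · apply hzl'
        rw [← hnonreal (star z) (star g) (by simpa using hneg) (star_ne_zero.2 hg)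
          (by rw [JacobiH0_mulVec_star, hgz, star_smul])]
        exact (star_star z).symm
      · exact hzl (hnonreal z g hpos hg hgz)
    have hunit : IsUnit (JacobiH0 a b n - z • 1).det := isUnit_iff_ne_zero.2 hdet
    refine ⟨(Matrix.isUnit_iff_isUnit_det _).2 hunit, ?_⟩
    obtain ⟨u, hu1, hu2⟩ := hu z hz hzl hzl'
    rw [← hH] at hu1
    have hcol : (JacobiH0 a b n - z • 1)⁻¹ 0 0 = u 0 := by
      have := congrArg (fun v => ((JacobiH0 a b n - z • 1)⁻¹).mulVec v) hu1
      simp only [Matrix.mulVec_mulVec, Matrix.nonsing_inv_mul _ hunit, Matrix.one_mulVec,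
        Matrix.mulVec_single_one] at this
      exact (congrFun this 0).symm
    rw [hcol, hu2]
    rfl
  · rintro rfl
    simp at hf0
  · rw [hf0]
    simpa using hf1
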